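/- arXiv:2405.11402 — 3 statements merged into one kernel-verified Lean document; each statement's English description precedes it below -/
import Mathlib

section
/- For all value functions V, V' : S → ℝ, the local Bellman operator satisfies ‖B V − B V'‖ ≤ γ · α⁺ · ‖V − V'‖; in particular, when γ · α⁺ < 1 the operator B is a contraction in the sup-norm with contraction factor γ · α⁺. -/
theorem Finset.abs_sup'_sub_sup'_le {ι : Type*} {s : Finset ι} (hs : s.Nonempty) {f g : ι → ℝ}
    {c : ℝ} (h : ∀ i ∈ s, |f i - g i| ≤ c) : |s.sup' hs f - s.sup' hs g| ≤ c := by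
  rw [abs_sub_le_iff, sub_le_iff_le_add', sub_le_iff_le_add']
  constructor <;> refine Finset.sup'_le hs _ fun i hi => ?_
  · linarith [Finset.le_sup' g hi, (abs_sub_le_iff.1 (h i hi)).1]
  · linarith [Finset.le_sup' f hi, (abs_sub_le_iff.1 (h i hi)).2]

theorem abs_sum_mul_le_of_sum_eq_one {ι : Type*} [Fintype ι] {p f : ι → ℝ} {c : ℝ}
    (hp : ∀ i, 0 ≤ p i) (hsum : ∑ i, p i = 1) (hf : ∀ i, |f i| ≤ c) :
    |∑ i, p i * f i| ≤ c :=
  calc |∑ i, p i * f i| ≤ ∑ i, |p i * f i| := Finset.abs_sum_le_sum_abs _ _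
    _ ≤ ∑ i, p i * c := Finset.sum_le_sum fun i _ => by
        rw [abs_mul, abs_of_nonneg (hp i)]
        exact mul_le_mul_of_nonneg_left (hf i) (hp i)
    _ = c := by rw [← Finset.sum_mul, hsum, one_mul]

theorem stmt0
    {S A : Type} [Fintype S] [Nonempty S] [Fintype A] [Nonempty A]
    (α : S → A → ℝ) (T F : S → A → S → ℝ) (R : S → A → ℝ) (γ : ℝ)
    (W : A → S → ℝ)
    (hα : ∀ s a, 0 ≤ α s a ∧ α s a ≤ 1)
    (hT : ∀ s a s', 0 ≤ T s a s') (hTsum : ∀ s a, ∑ s', T s a s' = 1)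
    (hF : ∀ s a s', 0 ≤ F s a s') (hFsum : ∀ s a, ∑ s', F s a s' = 1)
    (hγ : 0 ≤ γ ∧ γ ≤ 1)
    (B : (S → ℝ) → (S → ℝ))
    (hB : ∀ V s, B V s =
      Finset.univ.sup' Finset.univ_nonempty (fun a : A =>
        R s a + γ * ∑ s', (α s a * T s a s' * V s' +
          (1 - α s a) * F s a s' * W a s')))
    (norm' : (S → ℝ) → ℝ)
    (hnorm : ∀ V, norm' V = Finset.univ.sup' Finset.univ_nonempty (fun s : S => |V s|))
    (aplus : ℝ)
    (haplus : aplus = Finset.univ.sup' Finset.univ_nonempty (fun p : S × A => α p.1 p.2))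
    : ∀ V V' : S → ℝ,
      norm' (fun s => B V s - B V' s) ≤ γ * aplus * norm' (fun s => V s - V' s) := by
  intro V V'
  rw [hnorm]
  refine Finset.sup'_le _ _ fun s _ => ?_
  rw [hB, hB]
  refine Finset.abs_sup'_sub_sup'_le _ fun a _ => ?_
  have hle : ∀ s', |V s' - V' s'| ≤ norm' (fun s => V s - V' s) := fun s' => by
    rw [hnorm]
    exact Finset.le_sup' (fun s => |V s - V' s|) (Finset.mem_univ s')
  have hα_le : α s a ≤ aplus := by
    rw [haplus]
    exact Finset.le_sup' (fun p : S × A => α p.1 p.2) (Finset.mem_univ (s, a))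
  have hdiff : (R s a + γ * ∑ s', (α s a * T s a s' * V s' +
        (1 - α s a) * F s a s' * W a s')) -
      (R s a + γ * ∑ s', (α s a * T s a s' * V' s' + (1 - α s a) * F s a s' * W a s')) =
      γ * α s a * ∑ s', T s a s' * (V s' - V' s') := by
    rw [add_sub_add_left_eq_sub, ← mul_sub, ← Finset.sum_sub_distrib, mul_assoc]
    congr 1
    rw [Finset.mul_sum]
    exact Finset.sum_congr rfl fun s' _ => by ring
  have hγα : 0 ≤ γ * α s a := mul_nonneg hγ.1 (hα s a).1
  rw [hdiff, abs_mul, abs_of_nonneg hγα]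
  exact mul_le_mul (mul_le_mul_of_nonneg_left hα_le hγ.1)
    (abs_sum_mul_le_of_sum_eq_one (hT s a) (hTsum s a) hle) (abs_nonneg _)
    (mul_nonneg hγ.1 ((hα s a).1.trans hα_le))
end

section
/- If γ · α⁺ < 1, then the local Bellman operator B has a unique fixed point V* : S → ℝ, and for every initial value function V₀ : S → ℝ and every n ∈ ℕ, ‖Bⁿ V₀ − V*‖ ≤ (γ · α⁺)ⁿ · ‖V₀ − V*‖; hence the value-iteration sequence Bⁿ V₀ converges to V*. -/
theorem Pi.norm_eq_sup'_abs {ι : Type*} [Fintype ι] [Nonempty ι] (V : ι → ℝ) :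
    ‖V‖ = Finset.univ.sup' Finset.univ_nonempty (fun i => |V i|) := by
  apply le_antisymm
  · refine (pi_norm_le_iff_of_nonempty V).mpr fun i => ?_
    exact Finset.le_sup' (fun i => |V i|) (Finset.mem_univ i)
  · exact Finset.sup'_le _ _ fun i _ => norm_le_pi_norm V i

theorem abs_sum_mul_le_norm {ι : Type*} [Fintype ι] {p : ι → ℝ} (hp : ∀ i, 0 ≤ p i)
    (hsum : ∑ i, p i = 1) (V : ι → ℝ) : |∑ i, p i * V i| ≤ ‖V‖ :=
  calc |∑ i, p i * V i| ≤ ∑ i, |p i * V i| := Finset.abs_sum_le_sum_abs _ _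
    _ ≤ ∑ i, p i * ‖V‖ := Finset.sum_le_sum fun i _ => by
        rw [abs_mul, abs_of_nonneg (hp i)]
        exact mul_le_mul_of_nonneg_left (norm_le_pi_norm V i) (hp i)
    _ = ‖V‖ := by rw [← Finset.sum_mul, hsum, one_mul]


theorem stmt1
    {S A : Type} [Fintype S] [Nonempty S] [Fintype A] [Nonempty A]
    (α : S → A → ℝ) (T F : S → A → S → ℝ) (R : S → A → ℝ) (γ : ℝ)
    (W : A → S → ℝ)
    (hα : ∀ s a, 0 ≤ α s a ∧ α s a ≤ 1)
    (hT : ∀ s a s', 0 ≤ T s a s') (hTsum : ∀ s a, ∑ s', T s a s' = 1)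
    (hF : ∀ s a s', 0 ≤ F s a s') (hFsum : ∀ s a, ∑ s', F s a s' = 1)
    (hγ : 0 ≤ γ ∧ γ ≤ 1)
    (B : (S → ℝ) → (S → ℝ))
    (hB : ∀ V s, B V s =
      Finset.univ.sup' Finset.univ_nonempty (fun a : A =>
        R s a + γ * ∑ s', (α s a * T s a s' * V s' +
          (1 - α s a) * F s a s' * W a s')))
    (norm' : (S → ℝ) → ℝ)
    (hnorm : ∀ V, norm' V = Finset.univ.sup' Finset.univ_nonempty (fun s : S => |V s|))
    (aplus : ℝ)
    (haplus : aplus = Finset.univ.sup' Finset.univ_nonempty (fun p : S × A => α p.1 p.2))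
    (hlt : γ * aplus < 1)
    : ∃ Vstar : S → ℝ, B Vstar = Vstar ∧
      (∀ V : S → ℝ, B V = V → V = Vstar) ∧
      (∀ (V₀ : S → ℝ) (n : ℕ),
        norm' (fun s => (B^[n] V₀) s - Vstar s) ≤
          (γ * aplus) ^ n * norm' (fun s => V₀ s - Vstar s)) ∧
      (∀ V₀ : S → ℝ, Filter.Tendsto
        (fun n => norm' (fun s => (B^[n] V₀) s - Vstar s)) Filter.atTop (nhds 0)) := by
  have hle (s : S) (a : A) : α s a ≤ aplus :=
    haplus ▸ Finset.le_sup' (fun p : S × A => α p.1 p.2) (Finset.mem_univ (s, a))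
  have haplus0 : 0 ≤ aplus :=
    (hα (Classical.arbitrary S) (Classical.arbitrary A)).1.trans (hle _ _)
  have hk : 0 ≤ γ * aplus := mul_nonneg hγ.1 haplus0
  have hn (V : S → ℝ) : norm' V = ‖V‖ := (hnorm V).trans (Pi.norm_eq_sup'_abs V).symm
  have hlip : LipschitzWith (NNReal.mk (γ * aplus) hk) B := by
    refine LipschitzWith.of_dist_le_mul fun V U => ?_
    rw [dist_eq_norm, dist_eq_norm, NNReal.coe_mk, pi_norm_le_iff_of_nonempty]
    intro s
    rw [Pi.sub_apply, hB, hB, Real.norm_eq_abs]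
    refine Finset.abs_sup'_sub_sup'_le _ fun a _ => ?_
    have hdiff : (R s a + γ * ∑ s', (α s a * T s a s' * V s' +
          (1 - α s a) * F s a s' * W a s')) - (R s a + γ * ∑ s', (α s a * T s a s' * U s' +
          (1 - α s a) * F s a s' * W a s')) =
        γ * α s a * ∑ s', T s a s' * (V - U) s' := by
      rw [add_sub_add_left_eq_sub, ← mul_sub, ← Finset.sum_sub_distrib, mul_assoc,
        Finset.mul_sum (a := α s a)]
      congr 1
      refine Finset.sum_congr rfl fun s' _ => ?_
      rw [Pi.sub_apply]
      ring
    rw [hdiff, abs_mul, abs_of_nonneg (mul_nonneg hγ.1 (hα s a).1)]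
    exact mul_le_mul (mul_le_mul_of_nonneg_left (hle s a) hγ.1)
      (abs_sum_mul_le_norm (hT s a) (hTsum s a) _) (abs_nonneg _) hk
  have hc : ContractingWith (NNReal.mk (γ * aplus) hk) B := ⟨by exact_mod_cast hlt, hlip⟩
  have hfix : Function.IsFixedPt B (hc.fixedPoint B) := hc.fixedPoint_isFixedPt
  have hbound (V₀ : S → ℝ) (n : ℕ) :
      norm' (fun s => (B^[n] V₀) s - hc.fixedPoint B s) ≤
        (γ * aplus) ^ n * norm' (fun s => V₀ s - hc.fixedPoint B s) := by
    have h := (hlip.iterate n).dist_le_mul V₀ (hc.fixedPoint B)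
    rw [(hfix.iterate n).eq, dist_eq_norm, dist_eq_norm] at h
    rw [hn, hn]
    exact_mod_cast h
  refine ⟨hc.fixedPoint B, hfix, fun V hV => hc.fixedPoint_unique hV, hbound, fun V₀ => ?_⟩
  refine squeeze_zero (fun n => hn _ ▸ norm_nonneg _) (hbound V₀) ?_
  simpa using (tendsto_pow_atTop_nhds_zero_of_lt_one hk hlt).mul_const
    (norm' (fun s => V₀ s - hc.fixedPoint B s))
end

section
/- (Lemma 1 of the paper.) Suppose γ · α⁺ < 1 and V* : S → ℝ is a fixed point of B (B V* = V*). Then for every initial value function V₀ : S → ℝ and every n ≥ 1, ‖V* − Bⁿ V₀‖ ≤ λ · ‖Bⁿ V₀ − B^{n−1} V₀‖, where λ = (γ · α⁺)/(1 − γ · α⁺). -/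
/-- If every Bellman backup is affine in the value function with nonnegative weights of total mass
at most `c`, then the maximum of the backups increases by at most `c * d` when the value function
increases by at most `d`. -/
theorem sup'_affine_le_add {S A : Type*} [Fintype S] [Fintype A] [Nonempty A]
    (γ c d : ℝ) (r : A → ℝ) (w k : A → S → ℝ) (hγ : 0 ≤ γ) (hw : ∀ a s, 0 ≤ w a s)
    (hc : ∀ a, γ * ∑ s, w a s ≤ c) (hd : 0 ≤ d) (U V : S → ℝ) (hUV : ∀ s, U s ≤ V s + d) :
    Finset.univ.sup' Finset.univ_nonempty (fun a => r a + γ * ∑ s, (w a s * U s + k a s)) ≤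
      Finset.univ.sup' Finset.univ_nonempty (fun a => r a + γ * ∑ s, (w a s * V s + k a s)) +
        c * d := by
  refine Finset.sup'_le _ _ fun a _ => ?_
  have hV := Finset.le_sup' (fun a => r a + γ * ∑ s, (w a s * V s + k a s)) (Finset.mem_univ a)
  have hsum : ∑ s, (w a s * U s + k a s) ≤ ∑ s, (w a s * V s + k a s) + (∑ s, w a s) * d := by
    rw [Finset.sum_mul, ← Finset.sum_add_distrib]
    refine Finset.sum_le_sum fun s _ => ?_
    linarith [mul_le_mul_of_nonneg_left (hUV s) (hw a s), mul_add (w a s) (V s) d]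
  have hscaled := mul_le_mul_of_nonneg_left hsum hγ
  have hmass := mul_le_mul_of_nonneg_right (hc a) hd
  linarith

theorem stmt4
    {S A : Type} [Fintype S] [Nonempty S] [Fintype A] [Nonempty A]
    (α : S → A → ℝ) (T F : S → A → S → ℝ) (R : S → A → ℝ) (γ : ℝ)
    (W : A → S → ℝ)
    (hα : ∀ s a, 0 ≤ α s a ∧ α s a ≤ 1)
    (hT : ∀ s a s', 0 ≤ T s a s') (hTsum : ∀ s a, ∑ s', T s a s' = 1)
    (hF : ∀ s a s', 0 ≤ F s a s') (hFsum : ∀ s a, ∑ s', F s a s' = 1)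
    (hγ : 0 ≤ γ ∧ γ ≤ 1)
    (B : (S → ℝ) → (S → ℝ))
    (hB : ∀ V s, B V s =
      Finset.univ.sup' Finset.univ_nonempty (fun a : A =>
        R s a + γ * ∑ s', (α s a * T s a s' * V s' +
          (1 - α s a) * F s a s' * W a s')))
    (norm' : (S → ℝ) → ℝ)
    (hnorm : ∀ V, norm' V = Finset.univ.sup' Finset.univ_nonempty (fun s : S => |V s|))
    (aplus : ℝ)
    (haplus : aplus = Finset.univ.sup' Finset.univ_nonempty (fun p : S × A => α p.1 p.2))
    (hlt : γ * aplus < 1)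
    (Vstar : S → ℝ) (hfix : B Vstar = Vstar)
    : ∀ (V₀ : S → ℝ) (n : ℕ), 1 ≤ n →
      norm' (fun s => Vstar s - (B^[n] V₀) s) ≤
        (γ * aplus / (1 - γ * aplus)) *
          norm' (fun s => (B^[n] V₀) s - (B^[n - 1] V₀) s) := by
  intro V₀ n hn
  obtain ⟨m, rfl⟩ := Nat.exists_eq_add_of_le' hn
  rw [Nat.add_sub_cancel, Function.iterate_succ_apply']
  generalize B^[m] V₀ = U
  have hα_le : ∀ s a, α s a ≤ aplus := fun s a => by
    rw [haplus]
    exact Finset.le_sup' (fun p : S × A => α p.1 p.2) (Finset.mem_univ (s, a))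
  have abs_le_norm : ∀ V s, |V s| ≤ norm' V := fun V s => by
    rw [hnorm]
    exact Finset.le_sup' (fun s : S => |V s|) (Finset.mem_univ s)
  have backup_le : ∀ (X Y : S → ℝ) (d : ℝ), 0 ≤ d → (∀ s, X s ≤ Y s + d) →
      ∀ s, B X s ≤ B Y s + γ * aplus * d := fun X Y d hd hXY s => by
    rw [hB, hB]
    refine sup'_affine_le_add γ (γ * aplus) d (R s) (fun a s' => α s a * T s a s') _ hγ.1
      (fun a s' => mul_nonneg (hα s a).1 (hT s a s')) (fun a => ?_) hd X Y hXY
    rw [← Finset.mul_sum, hTsum, mul_one]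
    exact mul_le_mul_of_nonneg_left (hα_le s a) hγ.1
  set e := norm' (fun s => Vstar s - B U s)
  set d := norm' (fun s => B U s - U s)
  have he : ∀ s, |Vstar s - B U s| ≤ e := abs_le_norm _
  have hd : ∀ s, |B U s - U s| ≤ d := abs_le_norm _
  have hed : 0 ≤ e + d := by
    obtain ⟨s⟩ := ‹Nonempty S›
    exact add_nonneg ((abs_nonneg _).trans (he s)) ((abs_nonneg _).trans (hd s))
  have hcontract : e ≤ γ * aplus * (e + d) := by
    rw [show e = _ from hnorm _]
    refine Finset.sup'_le _ _ fun s _ => ?_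
    rw [← hnorm]
    change |Vstar s - B U s| ≤ γ * aplus * (e + d)
    have hupper := backup_le Vstar U (e + d) hed
      (fun s => by linarith [(abs_le.mp (he s)).2, (abs_le.mp (hd s)).2]) s
    have hlower := backup_le U Vstar (e + d) hed
      (fun s => by linarith [(abs_le.mp (he s)).1, (abs_le.mp (hd s)).1]) s
    rw [hfix] at hupper hlower
    exact abs_le.mpr ⟨by linarith, by linarith⟩
  rw [div_mul_eq_mul_div, le_div_iff₀ (by linarith)]
  linarith
end
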